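/- Let p ≥ 3 be an integer, let f = (f_{i,j}) be an infinite frieze pattern of type Λ_p, and let b ∈ ℤ. Let S_−(b) = {j ∈ ℤ : j ≤ b−2, f_{j,b} = 1} and S_+(b) = {j ∈ ℤ : j ≥ b+2, f_{b,j} = 1} (both sets are finite). Set b_{−1} = min S_−(b) if S_−(b) is nonempty and b_{−1} = b−1 otherwise, and set b_1 = max S_+(b) if S_+(b) is nonempty and b_1 = b+1 otherwise. Then f_{b−1,b+1} = f_{b_{−1},b_1} + λ_p·(|S_−(b)| + |S_+(b)|). -/

import Mathlib

/-- `lam p = λ_p = 2 cos (π / p)`. -/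
noncomputable def lam (p : ℕ) : ℝ := 2 * Real.cos (Real.pi / p)

/-- An infinite frieze pattern. -/
def IsInfFrieze (f : ℤ → ℤ → ℝ) : Prop :=
  (∀ i : ℤ, f i i = 0) ∧
  (∀ i : ℤ, f i (i + 1) = 1) ∧
  (∀ i j : ℤ, i + 1 ≤ j → 0 < f i j) ∧
  (∀ i j : ℤ, i + 1 ≤ j → f i j * f (i + 1) (j + 1) - f i (j + 1) * f (i + 1) j = 1)

/-- The frieze pattern is of type `Λ_p`. -/
def IsTypeLambda (p : ℕ) (f : ℤ → ℤ → ℝ) : Prop :=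
  ∀ i : ℤ, ∃ n : ℕ, 0 < n ∧ f i (i + 2) = n * lam p

/-- Determinant of two members of a sequence of plane vectors. -/
def DD (x y : ℕ → ℝ) (i j : ℕ) : ℝ := x i * y j - x j * y i

/-- A finite piece of a frieze of type Lambda, as a sequence of plane vectors. -/
structure Good (l : ℝ) (N : ℕ) (x y : ℕ → ℝ) : Prop where
  adj : ∀ s, s + 1 ≤ N → DD x y s (s + 1) = 1
  pos : ∀ s t, s < t → t ≤ N → 0 < DD x y s t
  rc : ∀ s, s + 2 ≤ N → ∃ n : ℕ, 1 ≤ n ∧ x (s + 2) = n * l * x (s + 1) - x s ∧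
    y (s + 2) = n * l * y (s + 1) - y s

/-- The sines. -/
noncomputable def sn (q m : ℕ) : ℝ := Real.sin (m * (Real.pi / ((q + 3 : ℕ) : ℝ)))

lemma sn_zero (q : ℕ) : sn q 0 = 0 := by simp [sn]

lemma sn_rec (q m : ℕ) : sn q (m + 2) = lam (q + 3) * sn q (m + 1) - sn q m := by
  unfold sn lam
  set θ := Real.pi / ((q + 3 : ℕ) : ℝ)
  have h1 : ((m + 2 : ℕ) : ℝ) * θ = ((m + 1 : ℕ) : ℝ) * θ + θ := by push_cast; ring
  have h2 : ((m : ℕ) : ℝ) * θ = ((m + 1 : ℕ) : ℝ) * θ - θ := by push_cast; ring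
  rw [h1, h2, Real.sin_add, Real.sin_sub]
  ring

lemma sn_pos (q m : ℕ) (h0 : 0 < m) (h1 : m < q + 3) : 0 < sn q m := by
  unfold sn
  have hq : (0 : ℝ) < ((q + 3 : ℕ) : ℝ) := by positivity
  have hm : (0 : ℝ) < (m : ℝ) := by exact_mod_cast h0
  have hm1 : (m : ℝ) < ((q + 3 : ℕ) : ℝ) := by exact_mod_cast h1
  apply Real.sin_pos_of_pos_of_lt_pi
  · have := Real.pi_pos
    positivity
  · rw [mul_div_assoc', div_lt_iff₀ hq]
    have := Real.pi_pos
    nlinarith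

lemma sn_symm (q m k : ℕ) (h : m + k = q + 3) : sn q m = sn q k := by
  unfold sn
  have hq : ((q + 3 : ℕ) : ℝ) ≠ 0 := by positivity
  have : (m : ℝ) * (Real.pi / ((q + 3 : ℕ) : ℝ)) =
      Real.pi - (k : ℝ) * (Real.pi / ((q + 3 : ℕ) : ℝ)) := by
    have h' : (m : ℝ) = ((q + 3 : ℕ) : ℝ) - k := by rw [← h]; push_cast; ring
    rw [h']; field_simp
  rw [this, Real.sin_pi_sub]

lemma sn_nonneg (q m : ℕ) (h1 : m ≤ q + 3) : 0 ≤ sn q m := by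
  rcases Nat.eq_zero_or_pos m with h | h
  · subst h; rw [sn_zero]
  · rcases Nat.lt_or_ge m (q + 3) with h2 | h2
    · exact (sn_pos q m h h2).le
    · rw [sn_symm q m 0 (by omega), sn_zero]

lemma lam_pos (q : ℕ) : 0 < lam (q + 3) := by
  have h := sn_rec q 0
  rw [sn_zero] at h
  have h1 := sn_pos q 1 (by omega) (by omega)
  have h2 := sn_pos q 2 (by omega) (by omega)
  simp only [zero_add, sub_zero] at h
  rw [h] at h2
  exact pos_of_mul_pos_left h2 h1.le

/-- Existence of an ear. -/
lemma ear_exists (q N : ℕ) (hN : 2 ≤ N) (u : ℕ → ℝ) (ν : ℕ → ℕ)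
    (h0 : u 0 = 0) (h1 : u 1 = 1) (hpos : ∀ t, 0 < t → t ≤ N → 0 < u t) (huN : u N = 1)
    (hν : ∀ s, s + 2 ≤ N → 1 ≤ ν s)
    (hrec : ∀ s, s + 2 ≤ N → u (s + 2) = ν s * lam (q + 3) * u (s + 1) - u s) :
    ∃ i, i + q + 2 ≤ N ∧ ∀ m, m ≤ q → ν (i + m) = 1 := by
  by_contra hcon
  push Not at hcon
  have hl := lam_pos q
  set l := lam (q + 3) with hldef
  have key : ∀ t, t + 1 ≤ N →
      (1 ≤ u t ^ 2 - l * u t * u (t + 1) + u (t + 1) ^ 2) ∧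
      (∃ m, m ≤ q ∧ m ≤ t ∧ (∀ k, k < m → ν (t - m + k) = 1) ∧
        u t * sn q (m + 2) < u (t + 1) * sn q (m + 1)) := by
    intro t
    induction t with
    | zero =>
      intro _
      refine ⟨by simp [h0, h1], 0, by omega, by omega, by intro k hk; omega, ?_⟩
      simp only [zero_add, h0, h1, zero_mul, one_mul]
      exact sn_pos q 1 (by omega) (by omega)
    | succ t ih =>
      intro ht
      obtain ⟨hQ, m, hmq, hmt, hones, hr⟩ := ih (by omega)
      have hu1 := hpos (t + 1) (by omega) (by omega)
      have hs2 := sn_pos q (m + 2) (by omega) (by omega)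
      have hs3 := sn_nonneg q (m + 3) (by omega)
      have hsr := sn_rec q (m + 1)
      rw [← hldef] at hsr
      have hsr' : sn q (m + 3) = l * sn q (m + 2) - sn q (m + 1) := hsr
      have hw : 0 < l * u (t + 1) - u t := by
        have : 0 < sn q (m + 2) * (l * u (t + 1) - u t) := by
          nlinarith [mul_nonneg hu1.le hs3]
        exact pos_of_mul_pos_right this hs2.le
      have hrt := hrec t (by omega)
      have hn := hν t (by omega)
      change (1 ≤ u (t + 1) ^ 2 - l * u (t + 1) * u (t + 2) + u (t + 2) ^ 2) ∧ _
      constructor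
      · have hn' : (0 : ℝ) ≤ (ν t : ℝ) - 1 := by
          have : (1 : ℝ) ≤ (ν t : ℝ) := by exact_mod_cast hn
          linarith
        have hd : u (t + 2) = (l * u (t + 1) - u t) + ((ν t : ℝ) - 1) * (l * u (t + 1)) := by
          rw [hrt]; ring
        have hlu : 0 < l * u (t + 1) := by positivity
        have hnn : (0 : ℝ) ≤ ((ν t : ℝ) - 1) * ((ν t : ℝ) - 2) := by
          rcases Nat.lt_or_ge (ν t) 2 with h | h
          · have : ν t = 1 := by omega
            rw [this]; norm_num
          · have : (2 : ℝ) ≤ (ν t : ℝ) := by exact_mod_cast h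
            exact mul_nonneg hn' (by linarith)
        rw [hd]
        have e1 : 0 ≤ ((ν t : ℝ) - 1) * (l * u (t + 1)) * (l * u (t + 1) - u t) := by positivity
        have e2 : 0 ≤ ((ν t : ℝ) - 1) * ((ν t : ℝ) - 2) * (l * u (t + 1)) ^ 2 := by positivity
        nlinarith
      · rcases Nat.lt_or_ge (ν t) 2 with h | h
        · have hv1 : ν t = 1 := by omega
          have hones' : ∀ k, k < m + 1 → ν (t + 1 - (m + 1) + k) = 1 := by
            intro k hk
            rcases Nat.lt_or_ge k m with h' | h'
            · have := hones k h'
              rwa [show t + 1 - (m + 1) + k = t - m + k by omega]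
            · rw [show t + 1 - (m + 1) + k = t by omega]; exact hv1
          have hmq' : m + 1 ≤ q := by
            by_contra hlt
            obtain ⟨k, hk, hk'⟩ := hcon (t - m) (by omega)
            apply hk'
            have := hones' k (by omega)
            rwa [show t + 1 - (m + 1) + k = t - m + k by omega] at this
          refine ⟨m + 1, hmq', by omega, hones', ?_⟩
          change u (t + 1) * sn q (m + 3) < u (t + 2) * sn q (m + 2)
          rw [hrt, hv1, hsr']
          push_cast
          nlinarith
        · refine ⟨0, by omega, by omega, by intro k hk; omega, ?_⟩
          have h2 : (2 : ℝ) ≤ (ν t : ℝ) := by exact_mod_cast h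
          have hs := sn_rec q 0
          rw [sn_zero, ← hldef] at hs
          simp only [zero_add, sub_zero] at hs ⊢
          change u (t + 1) * sn q 2 < u (t + 2) * sn q 1
          rw [hs, hrt]
          have hs1 := sn_pos q 1 (by omega) (by omega)
          have hlu : 0 < l * u (t + 1) := by positivity
          have : l * u (t + 1) < ν t * l * u (t + 1) - u t := by nlinarith
          nlinarith
  obtain ⟨t, rfl⟩ : ∃ t, N = t + 2 := ⟨N - 2, by omega⟩
  obtain ⟨hQ, m, hmq, hmt, hones, hr⟩ := key (t + 1) (by omega)
  change u (t + 1) * sn q (m + 2) < u (t + 2) * sn q (m + 1) at hr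
  change 1 ≤ u (t + 1) ^ 2 - l * u (t + 1) * u (t + 2) + u (t + 2) ^ 2 at hQ
  rw [huN] at hr hQ
  have hu1 := hpos (t + 1) (by omega) (by omega)
  have hs2 := sn_pos q (m + 2) (by omega) (by omega)
  have hs3 := sn_nonneg q (m + 3) (by omega)
  have hsr' : sn q (m + 3) = l * sn q (m + 2) - sn q (m + 1) := sn_rec q (m + 1)
  have hw : 0 < l - u (t + 1) := by
    have : 0 < sn q (m + 2) * (l - u (t + 1)) := by nlinarith
    exact pos_of_mul_pos_right this hs2.le
  nlinarith [mul_pos hu1 hw]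

lemma ear_vec (q i : ℕ) (x : ℕ → ℝ)
    (h : ∀ m, m ≤ q → x (i + m + 2) = lam (q + 3) * x (i + m + 1) - x (i + m)) :
    x (i + q + 2) = x (i + 1) - lam (q + 3) * x i ∧
    x (i + q + 1) = x i + lam (q + 3) * x (i + q + 2) := by
  have key : ∀ m, m ≤ q →
      sn q 1 * x (i + m + 1) = sn q (m + 1) * x (i + 1) - sn q m * x i ∧
      sn q 1 * x (i + m + 2) = sn q (m + 2) * x (i + 1) - sn q (m + 1) * x i := by
    intro m
    induction m with
    | zero =>
      intro _
      have := h 0 (by omega)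
      simp only [add_zero] at this
      have hs := sn_rec q 0
      simp only [zero_add] at hs
      simp only [add_zero, zero_add]
      rw [this, hs, sn_zero]
      constructor <;> ring
    | succ m ih =>
      intro hm
      obtain ⟨h1, h2⟩ := ih (by omega)
      have h3 := h (m + 1) hm
      have hs := sn_rec q (m + 1)
      refine ⟨h2, ?_⟩
      rw [h3, show m + 1 + 2 = m + 1 + 1 + 1 by rfl] at *
      have hs' := sn_rec q m
      have e1 : i + (m + 1) + 1 = i + m + 2 := by omega
      have e2 : i + (m + 1) = i + m + 1 := by omega
      rw [e1, e2]
      change _ = sn q (m + 1 + 2) * _ - sn q (m + 2) * _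
      rw [hs]
      linear_combination lam (q + 3) * h2 - h1 + x i * hs'
  obtain ⟨h1, h2⟩ := key q le_rfl
  have hs1 := sn_pos q 1 (by omega) (by omega)
  have ha : sn q (q + 2) = sn q 1 := sn_symm _ _ _ (by omega)
  have hb : sn q (q + 1) = sn q 2 := sn_symm _ _ _ (by omega)
  have hc : sn q q = sn q 3 := sn_symm _ _ _ (by omega)
  have hd : sn q 2 = lam (q + 3) * sn q 1 := by
    have := sn_rec q 0
    rw [sn_zero] at this
    simpa using this
  have he : sn q 3 = lam (q + 3) * sn q 2 - sn q 1 := sn_rec q 1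
  rw [ha, hb, hd] at h2
  rw [hb, hc, he, hd] at h1
  have g2 : x (i + q + 2) = x (i + 1) - lam (q + 3) * x i := by
    apply mul_left_cancel₀ hs1.ne'
    linear_combination h2
  refine ⟨g2, ?_⟩
  apply mul_left_cancel₀ hs1.ne'
  rw [g2]
  linear_combination h1

lemma claim (q : ℕ) : ∀ N, 2 ≤ N → ∀ x y : ℕ → ℝ, Good (lam (q + 3)) N x y →
    DD x y 0 N = 1 → ∃ j, 0 < j ∧ j < N ∧ DD x y 0 j = 1 ∧ DD x y j N = lam (q + 3) := by
  intro N
  induction N using Nat.strong_induction_on with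
  | _ N IH =>
  intro hN x y hG h1
  have hrc : ∀ s, ∃ n : ℕ, s + 2 ≤ N → 1 ≤ n ∧
      x (s + 2) = n * lam (q + 3) * x (s + 1) - x s ∧
      y (s + 2) = n * lam (q + 3) * y (s + 1) - y s := by
    intro s
    by_cases h : s + 2 ≤ N
    · obtain ⟨n, hn⟩ := hG.rc s h
      exact ⟨n, fun _ => hn⟩
    · exact ⟨0, fun h' => absurd h' h⟩
  choose ν hν using hrc
  obtain ⟨i, hi, hones⟩ := ear_exists q N hN (fun t => DD x y 0 t) ν (by simp [DD])
    (by simpa using hG.adj 0 (by omega)) (fun t h0 ht => hG.pos 0 t h0 ht) h1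
    (fun s hs => (hν s hs).1) (by
      intro s hs
      obtain ⟨_, hx, hy⟩ := hν s hs
      simp only [DD]
      rw [hx, hy]; ring)
  obtain ⟨x1, x2⟩ := ear_vec q i x (by
    intro m hm
    obtain ⟨_, hx, hy⟩ := hν (i + m) (by omega)
    rw [hones m hm] at hx
    simpa using hx)
  obtain ⟨y1, y2⟩ := ear_vec q i y (by
    intro m hm
    obtain ⟨_, hx, hy⟩ := hν (i + m) (by omega)
    rw [hones m hm] at hy
    simpa using hy)
  have hadji := hG.adj i (by omega)
  by_cases hcase : i = 0 ∧ N = q + 2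
  · obtain ⟨rfl, rfl⟩ := hcase
    refine ⟨1, by omega, by omega, by simpa using hadji, ?_⟩
    simp only [zero_add] at x1 y1 hadji
    simp only [DD] at hadji ⊢
    rw [x1, y1]
    linear_combination lam (q + 3) * hadji
  · let e : ℕ → ℕ := fun t => if t ≤ i then t else t + (q + 1)
    have elo : ∀ t, t ≤ i → e t = t := fun t ht => by simp [e, ht]
    have ehi : ∀ t, i < t → e t = t + (q + 1) := fun t ht => by
      simp [e, not_le.mpr ht]
    have emono : ∀ s t, s < t → e s < e t := by
      intro s t hst
      simp only [e]; split_ifs <;> omega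
    have eN : e (N - (q + 1)) = N := by rw [ehi _ (by omega)]; omega
    have e0 : e 0 = 0 := elo 0 (by omega)
    have ele : ∀ t, t ≤ N - (q + 1) → e t ≤ N := by
      intro t ht
      simp only [e]; split_ifs <;> omega
    have hpos' : ∀ s t, s < t → t ≤ N - (q + 1) → 0 < DD x y (e s) (e t) :=
      fun s t hst ht => hG.pos _ _ (emono s t hst) (ele t ht)
    have hnat : ∀ n : ℕ, 0 < ((n : ℝ) - 1) * lam (q + 3) → 1 ≤ n - 1 ∧ ((n - 1 : ℕ) : ℝ) = n - 1 := by
      intro n hn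
      have := pos_of_mul_pos_left hn (lam_pos q).le
      have h2 : 1 < n := by
        have : (1 : ℝ) < n := by linarith
        exact_mod_cast this
      refine ⟨by omega, ?_⟩
      rw [Nat.cast_sub h2.le]; simp
    have hG' : Good (lam (q + 3)) (N - (q + 1)) (fun t => x (e t)) (fun t => y (e t)) := by
      refine ⟨?_, ?_, ?_⟩
      · intro s hs
        change DD x y (e s) (e (s + 1)) = 1
        rcases lt_trichotomy s i with h | h | h
        · rw [elo s (by omega), elo (s + 1) (by omega)]
          exact hG.adj s (by omega)
        · subst h
          rw [elo s le_rfl, ehi (s + 1) (by omega), show s + 1 + (q + 1) = s + q + 2 by omega]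
          simp only [DD] at hadji ⊢
          rw [x1, y1]
          linear_combination hadji
        · rw [ehi s (by omega), ehi (s + 1) (by omega), show s + 1 + (q + 1) = s + (q + 1) + 1 by omega]
          exact hG.adj _ (by omega)
      · exact hpos'
      · intro s hs
        have hp := hpos' s (s + 2) (by omega) hs
        change ∃ n : ℕ, 1 ≤ n ∧ x (e (s + 2)) = n * lam (q + 3) * x (e (s + 1)) - x (e s) ∧
          y (e (s + 2)) = n * lam (q + 3) * y (e (s + 1)) - y (e s)
        rcases Nat.lt_or_ge (s + 1) i with h | h
        · rw [elo s (by omega), elo (s + 1) (by omega), elo (s + 2) (by omega)]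
          exact hG.rc s (by omega)
        rcases Nat.eq_or_lt_of_le h with h | h
        · subst h
          have es2 : e (s + 2) = s + 1 + q + 2 := by rw [ehi _ (by omega)]; omega
          rw [elo s (by omega), es2] at hp
          rw [elo s (by omega), elo (s + 1) (by omega), es2]
          obtain ⟨_, hx, hy⟩ := hν s (by omega)
          have ha := hG.adj s (by omega)
          have hx' : x (s + 1 + q + 2) = ((ν s : ℝ) - 1) * lam (q + 3) * x (s + 1) - x s := by
            rw [x1]; linear_combination hx
          have hy' : y (s + 1 + q + 2) = ((ν s : ℝ) - 1) * lam (q + 3) * y (s + 1) - y s := by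
            rw [y1]; linear_combination hy
          have hp' : 0 < ((ν s : ℝ) - 1) * lam (q + 3) := by
            simp only [DD] at hp ha
            rw [hx', hy'] at hp
            have : ((ν s : ℝ) - 1) * lam (q + 3) = ((ν s : ℝ) - 1) * lam (q + 3) * (x s * y (s + 1) - x (s + 1) * y s) := by
              rw [ha, mul_one]
            rw [this]
            linarith
          obtain ⟨g1, g2⟩ := hnat _ hp'
          exact ⟨ν s - 1, g1, by rw [g2]; exact hx', by rw [g2]; exact hy'⟩
        rcases Nat.eq_or_lt_of_le (Nat.lt_succ_iff.mp h) with h | h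
        · subst h
          have es1 : e (i + 1) = i + q + 2 := by rw [ehi _ (by omega)]; omega
          have es2 : e (i + 2) = i + q + 3 := by rw [ehi _ (by omega)]; omega
          rw [elo i (by omega), es2] at hp
          rw [elo i (by omega), es1, es2]
          obtain ⟨_, hx, hy⟩ := hν (i + q + 1) (by omega)
          have ha := hG.adj (i + q + 2) (by omega)
          have hx' : x (i + q + 3) = ((ν (i + q + 1) : ℝ) - 1) * lam (q + 3) * x (i + q + 2) - x i := by
            have : x (i + q + 1 + 2) = x (i + q + 3) := rfl
            linear_combination hx - x2
          have hy' : y (i + q + 3) = ((ν (i + q + 1) : ℝ) - 1) * lam (q + 3) * y (i + q + 2) - y i := by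
            have : y (i + q + 1 + 2) = y (i + q + 3) := rfl
            linear_combination hy - y2
          have hadj2 : x i * y (i + q + 2) - x (i + q + 2) * y i = 1 := by
            simp only [DD] at hadji
            rw [x1, y1]
            linear_combination hadji
          have hp' : 0 < ((ν (i + q + 1) : ℝ) - 1) * lam (q + 3) := by
            simp only [DD] at hp
            rw [hx', hy'] at hp
            have : ((ν (i + q + 1) : ℝ) - 1) * lam (q + 3) = ((ν (i + q + 1) : ℝ) - 1) * lam (q + 3) * (x i * y (i + q + 2) - x (i + q + 2) * y i) := by
              rw [hadj2, mul_one]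
            rw [this]
            linarith
          obtain ⟨g1, g2⟩ := hnat _ hp'
          exact ⟨ν (i + q + 1) - 1, g1, by rw [g2]; exact hx', by rw [g2]; exact hy'⟩
        · rw [ehi s (by omega), ehi (s + 1) (by omega), ehi (s + 2) (by omega),
            show s + 1 + (q + 1) = s + (q + 1) + 1 by omega,
            show s + 2 + (q + 1) = s + (q + 1) + 2 by omega]
          exact hG.rc _ (by omega)
    obtain ⟨j, hj0, hjN, hj1, hj2⟩ := IH (N - (q + 1)) (by omega) (by omega) _ _ hG' (by
      change DD x y (e 0) (e (N - (q + 1))) = 1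
      rw [e0, eN]; exact h1)
    change DD x y (e 0) (e j) = 1 at hj1
    change DD x y (e j) (e (N - (q + 1))) = _ at hj2
    rw [e0] at hj1
    rw [eN] at hj2
    have h3 := emono 0 j hj0
    have h4 := emono j _ hjN
    rw [e0] at h3
    rw [eN] at h4
    exact ⟨e j, h3, h4, hj1, hj2⟩

lemma Good.mono {l : ℝ} {N M : ℕ} {x y : ℕ → ℝ} (h : Good l N x y) (hM : M ≤ N) :
    Good l M x y :=
  ⟨fun s hs => h.adj s (by omega), fun s t hst ht => h.pos s t hst (by omega),
    fun s hs => h.rc s (by omega)⟩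

open Classical in
lemma half (q N : ℕ) (x y : ℕ → ℝ) (hG : Good (lam (q + 3)) N x y) :
    ∀ k, 1 ≤ k → k ≤ N → DD x y 0 k = 1 →
      DD x y 1 k = lam (q + 3) * (((Finset.Icc 2 k).filter (fun t => DD x y 0 t = 1)).card : ℝ) := by
  intro k
  induction k using Nat.strong_induction_on with
  | _ k IH =>
  intro hk hkN h1
  rcases Nat.eq_or_lt_of_le hk with h | h
  · subst h
    simp [DD]
  · obtain ⟨j, hj0, hjk, hj1, hj2⟩ := claim q k h x y (hG.mono hkN) h1
    have ihj := IH j hjk hj0 (by omega) hj1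
    have h01 : DD x y 0 1 = 1 := hG.adj 0 (by omega)
    -- additivity
    have hadd : ∀ s t, DD x y 0 s = 1 → DD x y 0 t = 1 → DD x y 1 t = DD x y 1 s + DD x y s t := by
      intro s t hs ht
      simp only [DD] at *
      linear_combination (x s * y t - x t * y s) * h01 - (x 1 * y t - x t * y 1) * hs
        - (x s * y 1 - x 1 * y s) * ht
    have hset : (Finset.Icc 2 k).filter (fun t => DD x y 0 t = 1) =
        insert k ((Finset.Icc 2 j).filter (fun t => DD x y 0 t = 1)) := by
      ext t
      simp only [Finset.mem_filter, Finset.mem_Icc, Finset.mem_insert]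
      constructor
      · rintro ⟨⟨ht2, htk⟩, ht1⟩
        by_cases htj : t ≤ j
        · exact Or.inr ⟨⟨ht2, htj⟩, ht1⟩
        rcases Nat.eq_or_lt_of_le htk with hh | hh
        · exact Or.inl hh
        exfalso
        have iht := IH t hh (by omega) (by omega) ht1
        have a1 := hadd j t hj1 ht1
        have a2 := hadd t k ht1 h1
        have a3 := hadd j k hj1 h1
        have p1 := hG.pos j t (by omega) (by omega)
        have p2 := hG.pos t k (by omega) (by omega)
        rw [iht, ihj] at a1
        rw [a3, iht, ihj, hj2] at a2
        have hl := lam_pos q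
        set A := ((Finset.Icc 2 t).filter (fun t => DD x y 0 t = 1)).card
        set B := ((Finset.Icc 2 j).filter (fun t => DD x y 0 t = 1)).card
        have c1 : (B : ℝ) < A := by
          refine lt_of_mul_lt_mul_left ?_ hl.le
          linarith
        have c2 : (A : ℝ) < B + 1 := by
          refine lt_of_mul_lt_mul_left ?_ hl.le
          linarith
        have c1' : B < A := by exact_mod_cast c1
        have c2' : A < B + 1 := by exact_mod_cast c2
        omega
      · rintro (rfl | ⟨⟨a, b⟩, c⟩)
        · exact ⟨⟨h, le_rfl⟩, h1⟩
        · exact ⟨⟨a, by omega⟩, c⟩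
    rw [hset, Finset.card_insert_of_notMem (by simp; omega), hadd j k hj1 h1, ihj, hj2]
    push_cast
    ring

lemma frieze_rec (f : ℤ → ℤ → ℝ) (hf : IsInfFrieze f) (j : ℤ) :
    ∀ d : ℕ, f (j - 1 - d) (j + 1) = f (j - 1) (j + 1) * f (j - 1 - d) j - f (j - 1 - d) (j - 1) := by
  obtain ⟨h0, h1, hp, hu⟩ := hf
  intro d
  induction d with
  | zero =>
    have := h1 (j - 1)
    rw [sub_add_cancel] at this
    simp [h0, this]
  | succ d ih =>
    have a := hu (j - 1 - (d + 1 : ℕ)) j (by push_cast; omega)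
    have b := hu (j - 1 - (d + 1 : ℕ)) (j - 1) (by push_cast; omega)
    rw [sub_add_cancel] at b
    rw [show j - 1 - ((d + 1 : ℕ) : ℤ) + 1 = j - 1 - d by push_cast; ring] at a b
    have pp := hp (j - 1 - d) j (by omega)
    apply mul_right_cancel₀ pp.ne'
    rw [ih] at a
    linear_combination b - a

lemma frieze_vec (f : ℤ → ℤ → ℝ) (hf : IsInfFrieze f) (c i : ℤ) (hc : c + 1 ≤ i) (d : ℕ) :
    f i (i + d) = f c i * f (c + 1) (i + d) - f c (i + d) * f (c + 1) i := by
  have hrec : ∀ a j : ℤ, a + 1 ≤ j →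
      f a (j + 1) = f (j - 1) (j + 1) * f a j - f a (j - 1) := by
    intro a j h
    have := frieze_rec f hf j (j - 1 - a).toNat
    rwa [show j - 1 - ((j - 1 - a).toNat : ℤ) = a by omega] at this
  obtain ⟨h0, h1, hp, hu⟩ := hf
  induction d using Nat.twoStepInduction with
  | zero => simp [h0]
  | one =>
    have := hu c i hc
    push_cast
    rw [h1]
    linarith
  | more d ih1 ih2 =>
    have e : i + ((d + 2 : ℕ) : ℤ) = i + ((d + 1 : ℕ) : ℤ) + 1 := by push_cast; ring
    have e' : i + ((d + 1 : ℕ) : ℤ) - 1 = i + (d : ℤ) := by push_cast; ring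
    rw [e, hrec i _ (by push_cast; omega), hrec c _ (by push_cast; omega),
      hrec (c + 1) _ (by push_cast; omega), e', ih1, ih2]
    ring

/-- The longest-arc formula: with `b₋₁` the left end of the longest arc in `Θ(F)` going
left from `b` (or `b - 1` if none exists) and `b₁` the right end of the longest arc going
right from `b` (or `b + 1` if none exists),
`f (b-1) (b+1) = f b₋₁ b₁ + λ_p · (#S₋(b) + #S₊(b))`. -/
theorem infFrieze_longest_arcs (p : ℕ) (hp : 3 ≤ p) (f : ℤ → ℤ → ℝ)
    (hf : IsInfFrieze f) (hl : IsTypeLambda p f) (b : ℤ)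
    (Sm Sp : Set ℤ)
    (hSm : Sm = {j : ℤ | j ≤ b - 2 ∧ f j b = 1})
    (hSp : Sp = {j : ℤ | b + 2 ≤ j ∧ f b j = 1})
    (hSmFin : Sm.Finite) (hSpFin : Sp.Finite)
    (bm bp : ℤ)
    (hbm : (Sm.Nonempty → IsLeast Sm bm) ∧ (¬ Sm.Nonempty → bm = b - 1))
    (hbp : (Sp.Nonempty → IsGreatest Sp bp) ∧ (¬ Sp.Nonempty → bp = b + 1)) :
    f (b - 1) (b + 1) = f bm bp + lam p * ((Sm.ncard : ℝ) + (Sp.ncard : ℝ)) := by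
  obtain ⟨q, rfl⟩ : ∃ q, p = q + 3 := ⟨p - 3, by omega⟩
  classical
  have hbm1 : bm ≤ b - 1 ∧ f bm b = 1 := by
    by_cases hne : Sm.Nonempty
    · have := (hbm.1 hne).1
      rw [hSm] at this
      exact ⟨by have := this.1; omega, this.2⟩
    · have h := hbm.2 hne
      subst h
      have := hf.2.1 (b - 1)
      rw [sub_add_cancel] at this
      exact ⟨le_rfl, this⟩
  have hbp1 : b + 1 ≤ bp ∧ f b bp = 1 := by
    by_cases hne : Sp.Nonempty
    · have := (hbp.1 hne).1
      rw [hSp] at this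
      exact ⟨by have := this.1; omega, this.2⟩
    · have h := hbp.2 hne
      subst h
      exact ⟨le_rfl, hf.2.1 b⟩
  obtain ⟨hbmb, hbm1⟩ := hbm1
  obtain ⟨hbpb, hbp1⟩ := hbp1
  obtain ⟨c, hc⟩ : ∃ c, c = bm - 2 := ⟨_, rfl⟩
  obtain ⟨X, hX⟩ : ∃ X : ℤ → ℝ, X = fun j => f c j := ⟨_, rfl⟩
  obtain ⟨Y, hY⟩ : ∃ Y : ℤ → ℝ, Y = fun j => f (c + 1) j := ⟨_, rfl⟩
  have F : ∀ i j : ℤ, c + 1 ≤ i → i ≤ j → f i j = X i * Y j - X j * Y i := by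
    intro i j h1 h2
    have := frieze_vec f hf c i h1 (j - i).toNat
    rw [show i + ((j - i).toNat : ℤ) = j by omega] at this
    rw [hX, hY]; exact this
  have R : ∀ j : ℤ, c + 2 ≤ j → ∃ n : ℕ, 1 ≤ n ∧
      X (j + 1) = n * lam (q + 3) * X j - X (j - 1) ∧
      Y (j + 1) = n * lam (q + 3) * Y j - Y (j - 1) := by
    intro j hj
    obtain ⟨n, hn, hn'⟩ := hl (j - 1)
    rw [show j - 1 + 2 = j + 1 by ring] at hn'
    refine ⟨n, hn, ?_, ?_⟩
    · have := frieze_rec f hf j (j - 1 - c).toNat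
      rw [show j - 1 - ((j - 1 - c).toNat : ℤ) = c by omega, hn'] at this
      rw [hX]; exact this
    · have := frieze_rec f hf j (j - 1 - (c + 1)).toNat
      rw [show j - 1 - ((j - 1 - (c + 1)).toNat : ℤ) = c + 1 by omega, hn'] at this
      rw [hY]; exact this
  -- right half
  have DR : ∀ s t : ℕ, s ≤ t →
      DD (fun t => X (b + t)) (fun t => Y (b + t)) s t = f (b + s) (b + t) := by
    intro s t hst
    rw [F _ _ (by omega) (by omega)]
    rfl
  have GR : Good (lam (q + 3)) (bp - b).toNat (fun t => X (b + t)) (fun t => Y (b + t)) := by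
    refine ⟨?_, ?_, ?_⟩
    · intro s _
      rw [DR s (s + 1) (by omega)]
      have := hf.2.1 (b + s)
      rw [← this]; congr 1; push_cast; ring
    · intro s t hst _
      rw [DR s t hst.le]
      exact hf.2.2.1 _ _ (by omega)
    · intro s _
      obtain ⟨n, hn, a1, a2⟩ := R (b + s + 1) (by omega)
      refine ⟨n, hn, ?_⟩
      simp only [Nat.cast_add, Nat.cast_one, Nat.cast_ofNat]
      rw [show b + s + 1 + 1 = b + (s + 2) by ring, show b + s + 1 - 1 = b + s by ring,
        show b + s + 1 = b + (s + 1) by ring] at a1 a2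
      exact ⟨a1, a2⟩
  have HR := half q _ _ _ GR (bp - b).toNat (by omega) le_rfl (by
    rw [DR _ _ (by omega), show b + ((bp - b).toNat : ℤ) = bp by omega]
    simpa using hbp1)
  rw [DR _ _ (by omega), show b + ((bp - b).toNat : ℤ) = bp by omega] at HR
  have CR : Sp.ncard = ((Finset.Icc 2 (bp - b).toNat).filter
      (fun t => DD (fun t => X (b + t)) (fun t => Y (b + t)) 0 t = 1)).card := by
    rw [← Set.ncard_coe_finset, ← Set.ncard_image_of_injective _
      (f := fun t : ℕ => b + (t : ℤ)) (by intro s t h; simpa using h)]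
    congr 1
    ext j
    simp only [Set.mem_image, Finset.coe_filter, Finset.mem_Icc, Set.mem_ofPred_eq]
    constructor
    · intro hj
      have hle := (hbp.1 ⟨j, hj⟩).2 hj
      rw [hSp] at hj
      obtain ⟨g1, g2⟩ := hj
      refine ⟨(j - b).toNat, ⟨⟨by omega, by omega⟩, ?_⟩, by omega⟩
      rw [DR _ _ (by omega), show b + ((j - b).toNat : ℤ) = j by omega]
      simpa using g2
    · rintro ⟨t, ⟨⟨g1, g2⟩, g3⟩, rfl⟩
      rw [DR _ _ (by omega)] at g3
      rw [hSp]
      exact ⟨by omega, by simpa using g3⟩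
  rw [← CR] at HR
  -- left half
  have DL : ∀ s t : ℕ, s ≤ t → t ≤ (b - bm).toNat →
      DD (fun t => Y (b - t)) (fun t => X (b - t)) s t = f (b - t) (b - s) := by
    intro s t hst ht
    rw [F _ _ (by omega) (by omega)]
    simp only [DD]; ring
  have GLeft : Good (lam (q + 3)) (b - bm).toNat (fun t => Y (b - t)) (fun t => X (b - t)) := by
    refine ⟨?_, ?_, ?_⟩
    · intro s hs
      rw [DL s (s + 1) (by omega) hs]
      have := hf.2.1 (b - s - 1)
      rw [← this]; congr 1 <;> (push_cast; ring)
    · intro s t hst ht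
      rw [DL s t hst.le ht]
      exact hf.2.2.1 _ _ (by omega)
    · intro s hs
      obtain ⟨n, hn, a1, a2⟩ := R (b - s - 1) (by omega)
      refine ⟨n, hn, ?_⟩
      simp only [Nat.cast_add, Nat.cast_one, Nat.cast_ofNat]
      rw [show b - s - 1 + 1 = b - s by ring, show b - s - 1 - 1 = b - (s + 2) by ring,
        show b - s - 1 = b - (s + 1) by ring] at a1 a2
      exact ⟨by linarith, by linarith⟩
  have HL := half q _ _ _ GLeft (b - bm).toNat (by omega) le_rfl (by
    rw [DL _ _ (by omega) le_rfl, show b - ((b - bm).toNat : ℤ) = bm by omega]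
    simpa using hbm1)
  rw [DL _ _ (by omega) le_rfl, show b - ((b - bm).toNat : ℤ) = bm by omega] at HL
  have CL : Sm.ncard = ((Finset.Icc 2 (b - bm).toNat).filter
      (fun t => DD (fun t => Y (b - t)) (fun t => X (b - t)) 0 t = 1)).card := by
    rw [← Set.ncard_coe_finset, ← Set.ncard_image_of_injective _
      (f := fun t : ℕ => b - (t : ℤ)) (by intro s t h; simpa using h)]
    congr 1
    ext j
    simp only [Set.mem_image, Finset.coe_filter, Finset.mem_Icc, Set.mem_ofPred_eq]
    constructor
    · intro hj
      have hle := (hbm.1 ⟨j, hj⟩).2 hj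
      rw [hSm] at hj
      obtain ⟨g1, g2⟩ := hj
      refine ⟨(b - j).toNat, ⟨⟨by omega, by omega⟩, ?_⟩, by omega⟩
      rw [DL _ _ (by omega) (by omega), show b - ((b - j).toNat : ℤ) = j by omega]
      simpa using g2
    · rintro ⟨t, ⟨⟨g1, g2⟩, g3⟩, rfl⟩
      rw [DL _ _ (by omega) g2] at g3
      rw [hSm]
      exact ⟨by omega, by simpa using g3⟩
  rw [← CL] at HL
  simp only [Nat.cast_one] at HL HR
  -- combine
  have hb1 : f b (b + 1) = 1 := hf.2.1 b
  have hb0 : f (b - 1) b = 1 := by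
    have := hf.2.1 (b - 1)
    rwa [sub_add_cancel] at this
  rw [mul_add, ← HL, ← HR]
  rw [F _ _ (by omega) (by omega)] at hb1 hb0 hbm1 hbp1
  rw [F (b - 1) (b + 1) (by omega) (by omega), F bm bp (by omega) (by omega),
    F bm (b - 1) (by omega) (by omega), F (b + 1) bp (by omega) (by omega)]
  -- express the far vectors in terms of the near ones
  set A := X (b + 1) * Y bp - X bp * Y (b + 1) with hA
  set B := X bm * Y (b - 1) - X (b - 1) * Y bm with hB
  have px : X bp = X (b + 1) - A * X b := by
    rw [hA]; linear_combination (-X bp) * hb1 + X (b + 1) * hbp1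
  have py : Y bp = Y (b + 1) - A * Y b := by
    rw [hA]; linear_combination (-Y bp) * hb1 + Y (b + 1) * hbp1
  have mx : X bm = X (b - 1) - B * X b := by
    rw [hB]; linear_combination (-X bm) * hb0 + X (b - 1) * hbm1
  have my : Y bm = Y (b - 1) - B * Y b := by
    rw [hB]; linear_combination (-Y bm) * hb0 + Y (b - 1) * hbm1
  clear_value A B
  rw [px, py, mx, my]
  linear_combination A * hb0 + B * hb1
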